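/- arXiv:1703.06392 — 2 statements merged into one kernel-verified Lean document; each statement's English description precedes it below -/
import Mathlib

section
/- Let B = (𝓑_i)_{i∈S} be a collection of finite nonempty subsets of ℤ^n and let J ⊆ S with complement J^c = S ∖ J. Then d(B) ≥ d(B_J) + d(π_J(B_{J^c})), where d(B_J) is the minimal defect of the subcollection (𝓑_i)_{i∈J} and d(π_J(B_{J^c})) is the minimal defect of the projected collection (π_J(𝓑_i))_{i∈J^c} computed in ℝ^n/L(J). -/
noncomputable section

/-- `L(J)`: the `ℝ`-linear span of all differences `a - b` with `a, b ∈ B i` for some `i ∈ J`. -/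
def colSpan {ι V : Type*} [AddCommGroup V] [Module ℝ V]
    (B : ι → Set V) (J : Set ι) : Submodule ℝ V :=
  Submodule.span ℝ {v | ∃ i ∈ J, ∃ a ∈ B i, ∃ b ∈ B i, v = a - b}

/-- The defect `def(J) = dim L(J) - |J|`. -/
def colDefect {ι V : Type*} [AddCommGroup V] [Module ℝ V]
    (B : ι → Set V) (J : Finset ι) : ℤ :=
  (Module.finrank ℝ (colSpan B (J : Set ι)) : ℤ) - (J.card : ℤ)

/-- The minimal defect `min_{J ⊆ S} def(J)` over all subsets of `S` (including `∅`). -/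
def colMinDefectOn {ι V : Type*} [AddCommGroup V] [Module ℝ V]
    (B : ι → Set V) (S : Finset ι) : ℤ :=
  S.powerset.inf' ⟨∅, Finset.empty_mem_powerset S⟩ (fun J => colDefect B J)

/-- A finite subset of `ℤ^n` viewed inside `ℝ^n`. -/
def realize {n : ℕ} (A : Finset (Fin n → ℤ)) : Set (Fin n → ℝ) :=
  (fun a : Fin n → ℤ => fun j => (a j : ℝ)) '' (A : Set (Fin n → ℤ))

/-- The projected collection `(π_J(B_i))_i` inside `ℝ^n / L(J)`. -/
def projColl {ι : Type*} {n : ℕ} (B : ι → Set (Fin n → ℝ)) (J : Set ι) :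
    ι → Set ((Fin n → ℝ) ⧸ colSpan B J) :=
  fun i => (colSpan B J).mkQ '' B i

theorem colSpan_mono {ι V : Type*} [AddCommGroup V] [Module ℝ V]
    (B : ι → Set V) {J K : Set ι} (h : J ⊆ K) : colSpan B J ≤ colSpan B K :=
  Submodule.span_mono fun _ ⟨i, hi, hv⟩ => ⟨i, h hi, hv⟩

theorem colSpan_image {ι V W : Type*} [AddCommGroup V] [Module ℝ V]
    [AddCommGroup W] [Module ℝ W] (f : V →ₗ[ℝ] W) (B : ι → Set V) (K : Set ι) :
    colSpan (fun i => f '' B i) K = (colSpan B K).map f := by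
  rw [colSpan, colSpan, Submodule.map_span]
  congr 1
  ext w
  constructor
  · rintro ⟨i, hi, _, ⟨a, ha, rfl⟩, _, ⟨b, hb, rfl⟩, rfl⟩
    exact ⟨a - b, ⟨i, hi, a, ha, b, hb, rfl⟩, map_sub f a b⟩
  · rintro ⟨_, ⟨i, hi, a, ha, b, hb, rfl⟩, rfl⟩
    exact ⟨i, hi, f a, ⟨a, ha, rfl⟩, f b, ⟨b, hb, rfl⟩, map_sub f a b⟩

theorem finrank_add_finrank_map_mkQ_le {k V : Type*} [DivisionRing k] [AddCommGroup V]
    [Module k V] [FiniteDimensional k V] {P N W : Submodule k V} (hPN : P ≤ N) (hPW : P ≤ W) :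
    Module.finrank k P + Module.finrank k (W.map N.mkQ) ≤ Module.finrank k W := by
  have h := (N.mkQ.domRestrict W).finrank_range_add_finrank_ker
  rw [LinearMap.range_domRestrict, LinearMap.ker_domRestrict, Submodule.ker_mkQ] at h
  have h' : Module.finrank k P ≤ Module.finrank k (N.comap W.subtype) := by
    rw [← (Submodule.comapSubtypeEquivOfLe hPW).finrank_eq]
    exact Submodule.finrank_mono (Submodule.comap_mono hPN)
  omega

theorem colMinDefectOn_le {ι V : Type*} [AddCommGroup V] [Module ℝ V]
    (B : ι → Set V) {S K : Finset ι} (h : K ⊆ S) : colMinDefectOn B S ≤ colDefect B K :=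
  Finset.inf'_le _ (Finset.mem_powerset.2 h)

/-- Splitting `K` along `J`: the defects of `K ∩ J` and of the projection of `K \ J` add up to at
most the defect of `K`. -/
theorem colDefect_inter_add_colDefect_projColl_le {n : ℕ} {ι : Type*} [DecidableEq ι]
    (B : ι → Set (Fin n → ℝ)) (J K : Finset ι) :
    colDefect B (K ∩ J) + colDefect (projColl B (J : Set ι)) (K \ J) ≤ colDefect B K := by
  have hP := finrank_add_finrank_map_mkQ_le
    (colSpan_mono B (Finset.coe_subset.2 (Finset.inter_subset_right (s₁ := K) (s₂ := J))))
    (colSpan_mono B (Finset.coe_subset.2 (Finset.inter_subset_left (s₁ := K) (s₂ := J))))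
  have hQ : Module.finrank ℝ (colSpan (projColl B (J : Set ι)) (↑(K \ J) : Set ι)) ≤
      Module.finrank ℝ ((colSpan B (K : Set ι)).map (colSpan B (J : Set ι)).mkQ) := by
    unfold projColl
    rw [colSpan_image]
    exact Submodule.finrank_mono
      (Submodule.map_mono (colSpan_mono B (Finset.coe_subset.2 Finset.sdiff_subset)))
  have hcard := Finset.card_inter_add_card_sdiff K J
  unfold colDefect
  omega

/-- `d(B) ≥ d(B_J) + d(π_J(B_{J^c}))`. -/
theorem minDefect_ge {n : ℕ} (hn : 1 ≤ n) {ι : Type*} [Fintype ι] [DecidableEq ι]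
    (B : ι → Finset (Fin n → ℤ)) (hB : ∀ i, (B i).Nonempty) (J : Finset ι) :
    colMinDefectOn (fun i => realize (B i)) J +
      colMinDefectOn (projColl (fun i => realize (B i)) (J : Set ι)) (Finset.univ \ J) ≤
    colMinDefectOn (fun i => realize (B i)) Finset.univ := by
  refine Finset.le_inf' _ _ fun K _ => ?_
  exact (add_le_add (colMinDefectOn_le _ Finset.inter_subset_right)
    (colMinDefectOn_le _ (Finset.sdiff_subset_sdiff (Finset.subset_univ K) subset_rfl))).trans
    (colDefect_inter_add_colDefect_projColl_le _ J K)
end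
end

section
/- Let A = (𝒜_1, …, 𝒜_n) be a collection of n finite nonempty subsets of ℤ^n with minimal defect d(A) = 0. Let M ⊆ ℤ^n be a subgroup, let T = {t ∈ (ℂ*)^n : t^m = 1 for all m ∈ M} (every algebraic subgroup of (ℂ*)^n is of this form), and let L_T ⊆ ℝ^n be the ℝ-linear span of M. Assume that T ∩ ker(G(A)) = {1} and that every proper subset J ⊊ {1, …, n} with L_T ⊆ L(J) has def(J) > 0. Then there exists a nonzero polynomial function F on Ω_A such that every f = (f_1, …, f_n) ∈ Ω_A having two distinct common zeros p, q ∈ (ℂ*)^n with p·q^{-1} ∈ T satisfies F(f) = 0 (i.e., the collection A is T-independent). -/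
noncomputable section

/-- The monomial `p^a = ∏_j p_j^{a_j}` as an element of `ℂˣ`. -/
def mon {n : ℕ} (p : Fin n → ℂˣ) (a : Fin n → ℤ) : ℂˣ :=
  ∏ j, p j ^ a j

/-- Evaluation of a Laurent polynomial `f` with support in `A` at `p ∈ (ℂ*)^n`:
`f(p) = ∑_{a ∈ A} f_a · p^a`. -/
def evalL {n : ℕ} {A : Finset (Fin n → ℤ)} (f : {x // x ∈ A} → ℂ) (p : Fin n → ℂˣ) : ℂ :=
  ∑ a : {x // x ∈ A}, f a * (mon p a.1 : ℂ)

/-- `t ∈ ker(G(A))`: every difference of two points of one of the supports takes value `1`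
at `t`. -/
def inKer {n k : ℕ} (A : Fin k → Finset (Fin n → ℤ)) (t : Fin n → ℂˣ) : Prop :=
  ∀ i, ∀ a ∈ A i, ∀ b ∈ A i, mon t (a - b) = 1

/-- The field of rational functions over `ℂ` in the variables `ι`. -/
abbrev RatFun (ι : Type) : Type := FractionRing (MvPolynomial ι ℂ)

/-- The pairs `(g, c)` where the rational function `g` is defined at `x` with value `c`. -/
def valueAlgebra {ι : Type} (x : ι → ℂ) : Subalgebra ℂ (RatFun ι × ℂ) where
  carrier := {g | ∃ P Q : MvPolynomial ι ℂ, MvPolynomial.eval x Q ≠ 0 ∧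
    g.1 * algebraMap _ (RatFun ι) Q = algebraMap _ (RatFun ι) P ∧
    g.2 * MvPolynomial.eval x Q = MvPolynomial.eval x P}
  mul_mem' := by
    rintro ⟨g, c⟩ ⟨g', c'⟩ ⟨P, Q, h0, h1, h2⟩ ⟨P', Q', h0', h1', h2'⟩
    refine ⟨P * P', Q * Q', by simp [h0, h0'], ?_, ?_⟩
    · simp only [map_mul, Prod.fst_mul] at *
      rw [← h1, ← h1']; ring
    · simp only [map_mul, Prod.snd_mul] at *
      rw [← h2, ← h2']; ring
  add_mem' := by
    rintro ⟨g, c⟩ ⟨g', c'⟩ ⟨P, Q, h0, h1, h2⟩ ⟨P', Q', h0', h1', h2'⟩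
    refine ⟨P * Q' + P' * Q, Q * Q', by simp [h0, h0'], ?_, ?_⟩
    · simp only [map_mul, map_add, Prod.fst_add] at *
      rw [← h1, ← h1']; ring
    · simp only [map_mul, map_add, Prod.snd_add] at *
      rw [← h2, ← h2']; ring
  algebraMap_mem' := fun r => ⟨MvPolynomial.C r, 1, by simp,
    by simp [IsScalarTower.algebraMap_apply ℂ (MvPolynomial ι ℂ) (RatFun ι),
      MvPolynomial.algebraMap_eq], by simp⟩

section valueAlgebra

variable {ι : Type} {x : ι → ℂ}

lemma valueAlgebra_X (i : ι) :
    (algebraMap (MvPolynomial ι ℂ) (RatFun ι) (MvPolynomial.X i), x i) ∈ valueAlgebra x :=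
  ⟨MvPolynomial.X i, 1, by simp, by simp, by simp⟩

lemma valueAlgebra_const (c : ℂ) : (algebraMap ℂ (RatFun ι) c, c) ∈ valueAlgebra x :=
  (valueAlgebra x).algebraMap_mem c

lemma valueAlgebra_zero : ((0 : RatFun ι), (0 : ℂ)) ∈ valueAlgebra x :=
  (valueAlgebra x).zero_mem

lemma valueAlgebra_mul {g g' : RatFun ι} {c c' : ℂ} (h : (g, c) ∈ valueAlgebra x)
    (h' : (g', c') ∈ valueAlgebra x) : (g * g', c * c') ∈ valueAlgebra x :=
  (valueAlgebra x).mul_mem h h'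

lemma valueAlgebra_sub {g g' : RatFun ι} {c c' : ℂ} (h : (g, c) ∈ valueAlgebra x)
    (h' : (g', c') ∈ valueAlgebra x) : (g - g', c - c') ∈ valueAlgebra x :=
  (valueAlgebra x).sub_mem h h'

lemma valueAlgebra_neg {g : RatFun ι} {c : ℂ} (h : (g, c) ∈ valueAlgebra x) :
    (-g, -c) ∈ valueAlgebra x :=
  (valueAlgebra x).neg_mem h

lemma valueAlgebra_inv {g : RatFun ι} {c : ℂ} (h : (g, c) ∈ valueAlgebra x) (hc : c ≠ 0) :
    (g⁻¹, c⁻¹) ∈ valueAlgebra x := by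
  obtain ⟨P, Q, h0, h1, h2⟩ := h
  have hP : MvPolynomial.eval x P ≠ 0 := by rw [← h2]; exact mul_ne_zero hc h0
  have hg : g ≠ 0 := by
    rintro rfl
    have : P = 0 := by simpa using h1.symm
    simp [this] at hP
  refine ⟨Q, P, hP, ?_, ?_⟩
  · simp only at h1 ⊢
    rw [← h1]; field_simp
  · simp only at h2 ⊢
    rw [← h2]; field_simp

lemma valueAlgebra_div {g g' : RatFun ι} {c c' : ℂ} (h : (g, c) ∈ valueAlgebra x)
    (h' : (g', c') ∈ valueAlgebra x) (hc : c' ≠ 0) : (g / g', c / c') ∈ valueAlgebra x := by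
  rw [div_eq_mul_inv, div_eq_mul_inv]
  exact valueAlgebra_mul h (valueAlgebra_inv h' hc)

lemma valueAlgebra_pow {g : RatFun ι} {c : ℂ} (h : (g, c) ∈ valueAlgebra x) (k : ℕ) :
    (g ^ k, c ^ k) ∈ valueAlgebra x :=
  (valueAlgebra x).pow_mem h k

lemma valueAlgebra_zpow {g : RatFun ι} {c : ℂ} (h : (g, c) ∈ valueAlgebra x) (hc : c ≠ 0)
    (k : ℤ) : (g ^ k, c ^ k) ∈ valueAlgebra x := by
  cases k with
  | ofNat k => simpa using valueAlgebra_pow h k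
  | negSucc k =>
    simp only [zpow_negSucc]
    exact valueAlgebra_inv (valueAlgebra_pow h _) (pow_ne_zero _ hc)

lemma valueAlgebra_sum {κ : Type*} (s : Finset κ) {g : κ → RatFun ι} {c : κ → ℂ}
    (h : ∀ k ∈ s, (g k, c k) ∈ valueAlgebra x) :
    (∑ k ∈ s, g k, ∑ k ∈ s, c k) ∈ valueAlgebra x := by
  have e : (∑ k ∈ s, g k, ∑ k ∈ s, c k) = ∑ k ∈ s, (g k, c k) :=
    Prod.ext (Prod.fst_sum (s := s) (f := fun k => (g k, c k))).symm
      (Prod.snd_sum (s := s) (f := fun k => (g k, c k))).symm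
  rw [e]
  exact (valueAlgebra x).sum_mem h

lemma valueAlgebra_prod {κ : Type*} (s : Finset κ) {g : κ → RatFun ι} {c : κ → ℂ}
    (h : ∀ k ∈ s, (g k, c k) ∈ valueAlgebra x) :
    (∏ k ∈ s, g k, ∏ k ∈ s, c k) ∈ valueAlgebra x := by
  have e : (∏ k ∈ s, g k, ∏ k ∈ s, c k) = ∏ k ∈ s, (g k, c k) :=
    Prod.ext (Prod.fst_prod (s := s) (f := fun k => (g k, c k))).symm
      (Prod.snd_prod (s := s) (f := fun k => (g k, c k))).symm
  rw [e]
  exact (valueAlgebra x).prod_mem h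

end valueAlgebra

lemma trdeg_ratFun (ι : Type) : Algebra.trdeg ℂ (RatFun ι) = Cardinal.mk ι := by
  have : Algebra.IsAlgebraic (MvPolynomial ι ℂ) (RatFun ι) :=
    IsLocalization.isAlgebraic _ (nonZeroDivisors (MvPolynomial ι ℂ))
  rw [← trdeg_add_eq ℂ (MvPolynomial ι ℂ), MvPolynomial.trdeg_of_isDomain,
    trdeg_eq_zero (R := MvPolynomial ι ℂ) (A := RatFun ι)]
  simp

/-- A set of points of affine space contained in a hypersurface. -/
def Thin {σ : Type} (s : Set (σ → ℂ)) : Prop :=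
  ∃ F : MvPolynomial σ ℂ, F ≠ 0 ∧ ∀ c ∈ s, MvPolynomial.eval c F = 0

lemma Thin.mono {σ : Type} {s t : Set (σ → ℂ)} (ht : Thin t) (h : s ⊆ t) : Thin s := by
  obtain ⟨F, hF, hF'⟩ := ht
  exact ⟨F, hF, fun c hc => hF' c (h hc)⟩

lemma Thin.biUnion {σ κ : Type} {I : Set κ} (hI : I.Finite) {s : κ → Set (σ → ℂ)}
    (h : ∀ k ∈ I, Thin (s k)) : Thin (⋃ k ∈ I, s k) := by
  choose! F hF hF' using h
  refine ⟨∏ k ∈ hI.toFinset, F k, Finset.prod_ne_zero_iff.2 (by simpa using hF), fun c hc => ?_⟩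
  simp only [Set.mem_iUnion] at hc
  obtain ⟨k, hk, hc⟩ := hc
  rw [map_prod]
  exact Finset.prod_eq_zero (by simpa using hk) (hF' k hk c hc)

/-- A set parametrized by rational functions in fewer parameters than the dimension of the
ambient space is contained in a hypersurface. -/
lemma thin_of_card_lt {ι σ : Type} [Fintype ι] [Fintype σ]
    (hcard : Fintype.card ι < Fintype.card σ) (y : σ → RatFun ι) :
    Thin {c : σ → ℂ | ∃ x, ∀ v, (y v, c v) ∈ valueAlgebra x} := by
  have hy : ¬ AlgebraicIndependent ℂ y := by
    intro hy
    have := hy.cardinalMk_le_trdeg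
    rw [trdeg_ratFun, Cardinal.mk_fintype, Cardinal.mk_fintype, Nat.cast_le] at this
    omega
  rw [algebraicIndependent_iff] at hy
  push Not at hy
  obtain ⟨F, hF, hF0⟩ := hy
  refine ⟨F, hF0, ?_⟩
  rintro c ⟨x, hx⟩
  obtain ⟨P, Q, h0, h1, h2⟩ :=
    (MvPolynomial.aeval (R := ℂ) (fun v => (⟨(y v, c v), hx v⟩ : valueAlgebra x)) F).2
  have e1 := MvPolynomial.comp_aeval_apply (fun v => (⟨(y v, c v), hx v⟩ : valueAlgebra x))
    ((AlgHom.fst ℂ (RatFun ι) ℂ).comp (valueAlgebra x).val) F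
  have e2 := MvPolynomial.comp_aeval_apply (fun v => (⟨(y v, c v), hx v⟩ : valueAlgebra x))
    ((AlgHom.snd ℂ (RatFun ι) ℂ).comp (valueAlgebra x).val) F
  simp only [AlgHom.comp_apply, Subalgebra.coe_val, AlgHom.fst_apply, AlgHom.snd_apply] at e1 e2
  rw [e1, hF] at h1
  rw [e2] at h2
  have hP : P = 0 := by simpa using h1.symm
  rw [hP, map_zero] at h2
  simpa [MvPolynomial.aeval_eq_eval, h0] using h2

section mon

variable {n : ℕ}

lemma mon_add (t : Fin n → ℂˣ) (a b : Fin n → ℤ) : mon t (a + b) = mon t a * mon t b := by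
  simp [mon, zpow_add, Finset.prod_mul_distrib]

lemma mon_zero (t : Fin n → ℂˣ) : mon t 0 = 1 := by simp [mon]

lemma mon_neg (t : Fin n → ℂˣ) (a : Fin n → ℤ) : mon t (-a) = (mon t a)⁻¹ := by
  simp [mon]

lemma mon_smul (t : Fin n → ℂˣ) (k : ℤ) (a : Fin n → ℤ) : mon t (k • a) = mon t a ^ k := by
  simp [mon, ← Finset.prod_zpow, mul_comm k, zpow_mul]

lemma mon_sum {κ : Type*} (s : Finset κ) (t : Fin n → ℂˣ) (a : κ → Fin n → ℤ) :
    mon t (∑ k ∈ s, a k) = ∏ k ∈ s, mon t (a k) := by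
  classical
  induction s using Finset.induction_on with
  | empty => simp [mon_zero]
  | insert k s hk ih => simp [Finset.sum_insert hk, Finset.prod_insert hk, mon_add, ih]

lemma mon_single (t : Fin n → ℂˣ) (j : Fin n) : mon t (Pi.single j 1) = t j := by
  rw [mon, Finset.prod_eq_single j] <;> simp +contextual

lemma mon_mul (s t : Fin n → ℂˣ) (a : Fin n → ℤ) : mon (s * t) a = mon s a * mon t a := by
  simp [mon, mul_zpow, Finset.prod_mul_distrib]

lemma mon_inv (t : Fin n → ℂˣ) (a : Fin n → ℤ) : mon t⁻¹ a = (mon t a)⁻¹ := by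
  simp [mon]

/-- Coordinates of a point of the torus from its values on a basis of the character lattice. -/
lemma eq_prod_mon_basis (t : Fin n → ℂˣ) (b : Module.Basis (Fin n) ℤ (Fin n → ℤ)) (j : Fin n) :
    t j = ∏ k, mon t (b k) ^ (b.repr (Pi.single j 1) k) := by
  rw [← mon_single t j]
  conv_lhs => rw [← b.sum_repr (Pi.single j 1), mon_sum]
  simp only [mon_smul]

end mon

/-- The inclusion of the lattice `ℤ^n` in `ℝ^n`. -/
def latticeEmb (n : ℕ) : (Fin n → ℤ) →ₗ[ℤ] (Fin n → ℝ) where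
  toFun a j := a j
  map_add' a b := by ext; simp
  map_smul' k a := by ext; simp

/-- Smith normal form for the subgroup of the torus annihilated by a lattice. -/
lemma exists_basis_of_submodule {n : ℕ} (N : Submodule ℤ (Fin n → ℤ)) :
    ∃ (r : ℕ) (f : Fin r ↪ Fin n) (b : Module.Basis (Fin n) ℤ (Fin n → ℤ))
      (Z : Set (Fin r → ℂˣ)), Z.Finite ∧
      Module.finrank ℝ (Submodule.span ℝ (latticeEmb n '' N)) ≤ r ∧
      ∀ t : Fin n → ℂˣ, (∀ m ∈ N, mon t m = 1) → (fun k => mon t (b (f k))) ∈ Z := by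
  obtain ⟨r, b, bN, f, d, snf⟩ := Submodule.smithNormalForm (Pi.basisFun ℤ (Fin n)) N
  have hd : ∀ k, d k ≠ 0 := by
    intro k hk
    apply bN.ne_zero k
    have := snf k
    simpa [hk] using this
  refine ⟨r, f, b, Set.univ.pi fun k => {z : ℂˣ | z ^ (d k).natAbs = 1}, ?_, ?_, ?_⟩
  · refine Set.Finite.pi fun k => ?_
    have : NeZero (d k).natAbs := ⟨by simpa using hd k⟩
    exact Set.finite_coe_iff.1 (inferInstanceAs (Finite (rootsOfUnity (d k).natAbs ℂ)))
  · have hle : Submodule.span ℝ (latticeEmb n '' N) ≤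
        Submodule.span ℝ (Set.range fun k => latticeEmb n (bN k : Fin n → ℤ)) := by
      rw [Submodule.span_le]
      rintro _ ⟨m, hm, rfl⟩
      have := congrArg (fun z : N => latticeEmb n (z : Fin n → ℤ)) (bN.sum_repr ⟨m, hm⟩)
      simp only [Submodule.coe_sum, Submodule.coe_smul, map_sum, map_smul] at this
      rw [← this]
      refine Submodule.sum_mem _ fun k _ => ?_
      rw [← Int.cast_smul_eq_zsmul ℝ]
      exact Submodule.smul_mem _ _ (Submodule.subset_span ⟨k, rfl⟩)
    refine (Submodule.finrank_mono hle).trans ?_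
    refine (finrank_range_le_card _).trans (by simp)
  · intro t ht k _
    have := ht _ (bN k).2
    rw [snf k, mon_smul] at this
    rw [Set.mem_ofPred_eq]
    rcases Int.natAbs_eq (d k) with h | h
    · rw [h, zpow_natCast] at this
      exact this
    · rw [h, zpow_neg, zpow_natCast, inv_eq_one] at this
      exact this

section parametrization

variable {n : ℕ} {K : Type*} [Field K]

/-- Laurent monomials over an arbitrary field. -/
def zmon (p : Fin n → K) (m : Fin n → ℤ) : K := ∏ j, p j ^ m j

lemma coe_mon (p : Fin n → ℂˣ) (m : Fin n → ℤ) : (mon p m : ℂ) = zmon (fun j => (p j : ℂ)) m := by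
  simp [mon, zmon]

variable {A : Fin n → Finset (Fin n → ℤ)}

/-- Evaluation of a Laurent polynomial over an arbitrary field. -/
def zeval (e : ((i : Fin n) × {x // x ∈ A i}) → K) (p : Fin n → K) (i : Fin n) : K :=
  ∑ c : {x // x ∈ A i}, e ⟨i, c⟩ * zmon p c.1

/-- Coefficients determined by the two equations: `a i` for `i ∈ J`, `a i` and `b i` for
`i ∉ J`. -/
def IsDetermined (J : Finset (Fin n)) (a b : ∀ i, {x // x ∈ A i})
    (v : (i : Fin n) × {x // x ∈ A i}) : Prop :=
  v.2 = a v.1 ∨ (v.1 ∉ J ∧ v.2 = b v.1)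

open Classical in
/-- The coefficients of a system vanishing at `p` and `q`, in terms of the free ones. -/
def solveCoeff (J : Finset (Fin n)) (a b : ∀ i, {x // x ∈ A i})
    (e : ((i : Fin n) × {x // x ∈ A i}) → K) (p q : Fin n → K)
    (v : (i : Fin n) × {x // x ∈ A i}) : K :=
  if v.1 ∈ J then
    if v.2 = a v.1 then -zeval e p v.1 / zmon p (a v.1).1 else e v
  else if v.2 = a v.1 then
    (zeval e q v.1 * zmon p (b v.1).1 - zeval e p v.1 * zmon q (b v.1).1) /
      (zmon p (a v.1).1 * zmon q (b v.1).1 - zmon p (b v.1).1 * zmon q (a v.1).1)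
  else if v.2 = b v.1 then
    (zeval e p v.1 * zmon q (a v.1).1 - zeval e q v.1 * zmon p (a v.1).1) /
      (zmon p (a v.1).1 * zmon q (b v.1).1 - zmon p (b v.1).1 * zmon q (a v.1).1)
  else e v

open Classical in
lemma zeval_eq_of_mem {J : Finset (Fin n)} {a b : ∀ i, {x // x ∈ A i}}
    (c : ((i : Fin n) × {x // x ∈ A i}) → K) (p : Fin n → K) {i : Fin n} (hi : i ∈ J) :
    zeval c p i = zeval (fun v => if IsDetermined J a b v then 0 else c v) p i +
      c ⟨i, a i⟩ * zmon p (a i).1 := by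
  have : c ⟨i, a i⟩ * zmon p (a i).1 =
      ∑ x : {x // x ∈ A i}, if x = a i then c ⟨i, x⟩ * zmon p x.1 else 0 := by simp
  rw [this, zeval, zeval, ← Finset.sum_add_distrib]
  refine Finset.sum_congr rfl fun x _ => ?_
  by_cases hx : x = a i <;> simp [IsDetermined, hi, hx]

open Classical in
lemma zeval_eq_of_notMem {J : Finset (Fin n)} {a b : ∀ i, {x // x ∈ A i}}
    (c : ((i : Fin n) × {x // x ∈ A i}) → K) (p : Fin n → K) {i : Fin n} (hi : i ∉ J)
    (hab : a i ≠ b i) :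
    zeval c p i = zeval (fun v => if IsDetermined J a b v then 0 else c v) p i +
      (c ⟨i, a i⟩ * zmon p (a i).1 + c ⟨i, b i⟩ * zmon p (b i).1) := by
  have h (d : {x // x ∈ A i}) : c ⟨i, d⟩ * zmon p d.1 =
      ∑ x : {x // x ∈ A i}, if x = d then c ⟨i, x⟩ * zmon p x.1 else 0 := by simp
  rw [h (a i), h (b i), zeval, zeval, ← Finset.sum_add_distrib, ← Finset.sum_add_distrib]
  refine Finset.sum_congr rfl fun x _ => ?_
  by_cases hx : x = a i
  · subst hx; simp [IsDetermined, hi, hab]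
  · by_cases hx' : x = b i <;> simp [IsDetermined, hi, hx, hx', hab.symm]

open Classical in
lemma solveCoeff_eq {J : Finset (Fin n)} {a b : ∀ i, {x // x ∈ A i}}
    (c : ((i : Fin n) × {x // x ∈ A i}) → K) {p q : Fin n → K} (hp : ∀ j, p j ≠ 0)
    (hcp : ∀ i, zeval c p i = 0) (hcq : ∀ i, zeval c q i = 0)
    (hdet : ∀ i ∉ J, zmon p (a i).1 * zmon q (b i).1 ≠ zmon p (b i).1 * zmon q (a i).1)
    (v : (i : Fin n) × {x // x ∈ A i}) :
    solveCoeff J a b (fun v => if IsDetermined J a b v then 0 else c v) p q v = c v := by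
  obtain ⟨i, x⟩ := v
  by_cases hi : i ∈ J
  · by_cases hx : x = a i
    · have h := (zeval_eq_of_mem (a := a) (b := b) c p hi).symm.trans (hcp i)
      have h0 : zmon p (a i).1 ≠ 0 := Finset.prod_ne_zero_iff.2 fun j _ => zpow_ne_zero _ (hp j)
      subst hx
      simp only [solveCoeff, hi, if_true]
      rw [div_eq_iff h0]
      linear_combination -h
    · simp [solveCoeff, hi, hx, IsDetermined]
  · have h0 := sub_ne_zero.2 (hdet i hi)
    have hab : a i ≠ b i := by
      intro h; exact hdet i hi (by rw [h])
    have h := (zeval_eq_of_notMem c p hi hab).symm.trans (hcp i)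
    have h' := (zeval_eq_of_notMem c q hi hab).symm.trans (hcq i)
    by_cases hx : x = a i
    · subst hx
      simp only [solveCoeff, hi, if_true, if_false]
      rw [div_eq_iff h0]
      linear_combination zmon p (b i).1 * h' - zmon q (b i).1 * h
    · by_cases hx' : x = b i
      · subst hx'
        simp only [solveCoeff, hi, hx, if_true, if_false]
        rw [div_eq_iff h0]
        linear_combination zmon q (a i).1 * h - zmon p (a i).1 * h'
      · simp [solveCoeff, hi, hx, hx', IsDetermined]

end parametrization

section valueAlgebra

variable {n : ℕ} {ι : Type} {x : ι → ℂ} {A : Fin n → Finset (Fin n → ℤ)}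

lemma valueAlgebra_zmon {P : Fin n → RatFun ι} {p : Fin n → ℂ}
    (h : ∀ j, (P j, p j) ∈ valueAlgebra x) (hp : ∀ j, p j ≠ 0) (m : Fin n → ℤ) :
    (zmon P m, zmon p m) ∈ valueAlgebra x :=
  valueAlgebra_prod _ fun j _ => valueAlgebra_zpow (h j) (hp j) _

lemma valueAlgebra_zeval {P : Fin n → RatFun ι} {p : Fin n → ℂ}
    (h : ∀ j, (P j, p j) ∈ valueAlgebra x) (hp : ∀ j, p j ≠ 0)
    {E : ((i : Fin n) × {x // x ∈ A i}) → RatFun ι} {e : ((i : Fin n) × {x // x ∈ A i}) → ℂ}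
    (he : ∀ v, (E v, e v) ∈ valueAlgebra x) (i : Fin n) :
    (zeval E P i, zeval e p i) ∈ valueAlgebra x :=
  valueAlgebra_sum _ fun _ _ => valueAlgebra_mul (he _) (valueAlgebra_zmon h hp _)

lemma valueAlgebra_solveCoeff {J : Finset (Fin n)} {a b : ∀ i, {x // x ∈ A i}}
    {P Q : Fin n → RatFun ι} {p q : Fin n → ℂ}
    (hP : ∀ j, (P j, p j) ∈ valueAlgebra x) (hp : ∀ j, p j ≠ 0)
    (hQ : ∀ j, (Q j, q j) ∈ valueAlgebra x) (hq : ∀ j, q j ≠ 0)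
    {E : ((i : Fin n) × {x // x ∈ A i}) → RatFun ι} {e : ((i : Fin n) × {x // x ∈ A i}) → ℂ}
    (he : ∀ v, (E v, e v) ∈ valueAlgebra x)
    (hdet : ∀ i ∉ J, zmon p (a i).1 * zmon q (b i).1 ≠ zmon p (b i).1 * zmon q (a i).1)
    (v : (i : Fin n) × {x // x ∈ A i}) :
    (solveCoeff J a b E P Q v, solveCoeff J a b e p q v) ∈ valueAlgebra x := by
  have mp := valueAlgebra_zmon hP hp
  have mq := valueAlgebra_zmon hQ hq
  have ep := valueAlgebra_zeval hP hp he
  have eq := valueAlgebra_zeval hQ hq he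
  unfold solveCoeff
  split_ifs with h1 h2 h3 h4
  · exact valueAlgebra_div (valueAlgebra_neg (ep _)) (mp _)
      (Finset.prod_ne_zero_iff.2 fun j _ => zpow_ne_zero _ (hp j))
  · exact he v
  · exact valueAlgebra_div
      (valueAlgebra_sub (valueAlgebra_mul (eq _) (mp _)) (valueAlgebra_mul (ep _) (mq _)))
      (valueAlgebra_sub (valueAlgebra_mul (mp _) (mq _)) (valueAlgebra_mul (mp _) (mq _)))
      (sub_ne_zero.2 (hdet _ h1))
  · exact valueAlgebra_div
      (valueAlgebra_sub (valueAlgebra_mul (ep _) (mq _)) (valueAlgebra_mul (eq _) (mp _)))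
      (valueAlgebra_sub (valueAlgebra_mul (mp _) (mq _)) (valueAlgebra_mul (mp _) (mq _)))
      (sub_ne_zero.2 (hdet _ h1))
  · exact he v

end valueAlgebra

/-- The number of determined coefficients is at least `2 n - |J|`. -/
lemma card_isDetermined {n : ℕ} {A : Fin n → Finset (Fin n → ℤ)} {J : Finset (Fin n)}
    {a b : ∀ i, {x // x ∈ A i}} (hab : ∀ i ∉ J, a i ≠ b i) :
    n + (n - J.card) ≤ Nat.card {v // IsDetermined J a b v} := by
  classical
  let g : Fin n ⊕ {i // i ∉ J} → {v // IsDetermined J a b v} :=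
    Sum.elim (fun i => ⟨⟨i, a i⟩, Or.inl rfl⟩) (fun i => ⟨⟨i.1, b i.1⟩, Or.inr ⟨i.2, rfl⟩⟩)
  have hg : Function.Injective g := by
    rintro (i | ⟨i, hi⟩) (j | ⟨j, hj⟩) h
    · have := congrArg (fun z => z.1.1) h
      simpa [g] using this
    · have h1 := congrArg (fun z => z.1.1) h
      simp only [g, Sum.elim_inl, Sum.elim_inr] at h1
      subst h1
      exact absurd (by simpa [g] using congrArg Subtype.val h) (hab _ hj)
    · have h1 := congrArg (fun z => z.1.1) h
      simp only [g, Sum.elim_inl, Sum.elim_inr] at h1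
      subst h1
      exact absurd (by simpa [g] using congrArg Subtype.val h.symm) (hab _ hi)
    · have := congrArg (fun z => z.1.1) h
      simpa [g] using this
  have := Nat.card_le_card_of_injective g hg
  rw [Nat.card_sum] at this
  simpa [Nat.card_eq_fintype_card, Fintype.card_subtype_compl] using this

open Classical in
/-- Systems with two common zeros whose ratio lies in a fixed coset of codimension `r > |J|`,
where the equations indexed by `J` need not distinguish the two zeros, form a thin set. -/
lemma thin_of_card_lt_rank {n r : ℕ} {A : Fin n → Finset (Fin n → ℤ)} {J : Finset (Fin n)}
    (hJ : J.card < r) (a b : ∀ i, {x // x ∈ A i}) (f : Fin r ↪ Fin n)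
    (B : Module.Basis (Fin n) ℤ (Fin n → ℤ)) (ζ : Fin r → ℂˣ) :
    Thin {c : ((i : Fin n) × {x // x ∈ A i}) → ℂ | ∃ p t : Fin n → ℂˣ,
      (∀ k, mon t (B (f k)) = ζ k) ∧
      (∀ i ∉ J, mon p (a i).1 * mon (p * t) (b i).1 ≠ mon p (b i).1 * mon (p * t) (a i).1) ∧
      (∀ i, evalL (fun x => c ⟨i, x⟩) p = 0) ∧
      (∀ i, evalL (fun x => c ⟨i, x⟩) (p * t) = 0)} := by
  by_cases hab : ∀ i ∉ J, a i ≠ b i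
  swap
  · refine ⟨1, one_ne_zero, ?_⟩
    rintro c ⟨p, t, -, hdet, -⟩
    push Not at hab
    obtain ⟨i, hi, h⟩ := hab
    exact absurd (by rw [h]) (hdet i hi)
  let ι := {v // ¬ IsDetermined J a b v} ⊕ Fin n ⊕ {k // k ∉ Set.range f}
  have hcard : Fintype.card ι < Fintype.card ((i : Fin n) × {x // x ∈ A i}) := by
    have h1 := card_isDetermined hab
    have h2 : Fintype.card {k // k ∉ Set.range f} = n - r := by
      rw [Fintype.card_subtype_compl,
        ← Fintype.card_congr (Equiv.ofInjective f f.injective), Fintype.card_fin,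
        Fintype.card_fin]
    have h3 := Fintype.card_subtype_compl (IsDetermined J a b)
    have h4 := Fintype.card_subtype_le (IsDetermined J a b)
    have h5 : r ≤ n := by simpa using Fintype.card_le_of_embedding f
    rw [Nat.card_eq_fintype_card] at h1
    simp only [ι, Fintype.card_sum, Fintype.card_fin, h2, h3]
    omega
  let X (i : ι) : RatFun ι := algebraMap (MvPolynomial ι ℂ) (RatFun ι) (MvPolynomial.X i)
  let P (j : Fin n) : RatFun ι := X (Sum.inr (Sum.inl j))
  let W (k : Fin n) : RatFun ι :=
    if h : ∃ l, f l = k then algebraMap ℂ (RatFun ι) (ζ h.choose)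
    else X (Sum.inr (Sum.inr ⟨k, h⟩))
  let Q (j : Fin n) : RatFun ι := P j * ∏ k, W k ^ (B.repr (Pi.single j 1) k)
  let E (v : (i : Fin n) × {x // x ∈ A i}) : RatFun ι :=
    if h : IsDetermined J a b v then 0 else X (Sum.inl ⟨v, h⟩)
  refine (thin_of_card_lt hcard (solveCoeff J a b E P Q)).mono ?_
  rintro c ⟨p, t, hζ, hdet, hcp, hcq⟩
  let x : ι → ℂ := Sum.elim (fun v => c v.1)
    (Sum.elim (fun j => (p j : ℂ)) (fun k => (mon t (B k.1) : ℂ)))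
  have hX (i : ι) : (X i, x i) ∈ valueAlgebra x := valueAlgebra_X i
  have hP (j : Fin n) : (P j, (p j : ℂ)) ∈ valueAlgebra x := hX (Sum.inr (Sum.inl j))
  have hW (k : Fin n) : (W k, (mon t (B k) : ℂ)) ∈ valueAlgebra x := by
    by_cases h : ∃ l, f l = k
    · have : W k = algebraMap ℂ (RatFun ι) (ζ h.choose) := dif_pos h
      rw [this, ← hζ, h.choose_spec]
      exact valueAlgebra_const _
    · have : W k = X (Sum.inr (Sum.inr ⟨k, h⟩)) := dif_neg h
      rw [this]
      exact hX (Sum.inr (Sum.inr ⟨k, h⟩))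
  have hQ (j : Fin n) : (Q j, ((p * t) j : ℂ)) ∈ valueAlgebra x := by
    have ht := congrArg (Units.val) (eq_prod_mon_basis t B j)
    rw [Units.coe_prod] at ht
    rw [Pi.mul_apply, Units.val_mul, ht]
    refine valueAlgebra_mul (hP j) (valueAlgebra_prod _ fun k _ => ?_)
    rw [Units.val_zpow_eq_zpow_val]
    exact valueAlgebra_zpow (hW k) (Units.ne_zero _) _
  have hE (v) : (E v, if IsDetermined J a b v then 0 else c v) ∈ valueAlgebra x := by
    by_cases h : IsDetermined J a b v
    · simpa [E, h] using valueAlgebra_zero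
    · simpa [E, h, x] using hX (Sum.inl ⟨v, h⟩)
  have hdet' : ∀ i ∉ J, zmon (fun j => (p j : ℂ)) (a i).1 *
      zmon (fun j => ((p * t) j : ℂ)) (b i).1 ≠
      zmon (fun j => (p j : ℂ)) (b i).1 * zmon (fun j => ((p * t) j : ℂ)) (a i).1 := by
    intro i hi h
    apply hdet i hi
    simp only [← coe_mon] at h
    exact_mod_cast h
  have heval (s : Fin n → ℂˣ) (hs : ∀ i, evalL (fun x => c ⟨i, x⟩) s = 0) (i : Fin n) :
      zeval c (fun j => (s j : ℂ)) i = 0 := by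
    simpa only [evalL, zeval, coe_mon] using hs i
  refine ⟨x, fun v => ?_⟩
  rw [← solveCoeff_eq c (fun j => (p j).ne_zero) (heval p hcp) (heval _ hcq) hdet' v]
  exact valueAlgebra_solveCoeff hP (fun j => (p j).ne_zero) hQ (fun j => Units.ne_zero _) hE
    hdet' v

section lattice

variable {n : ℕ}

/-- The lattice generated by `M` and the differences of the supports indexed by `J`. -/
def differenceLattice (A : Fin n → Finset (Fin n → ℤ)) (M : AddSubgroup (Fin n → ℤ))
    (J : Finset (Fin n)) : Submodule ℤ (Fin n → ℤ) :=
  Submodule.span ℤ ((M : Set (Fin n → ℤ)) ∪ {m | ∃ i ∈ J, ∃ a ∈ A i, ∃ b ∈ A i, m = a - b})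

lemma mon_eq_one_of_mem_differenceLattice {A : Fin n → Finset (Fin n → ℤ)}
    {M : AddSubgroup (Fin n → ℤ)} {J : Finset (Fin n)} {t : Fin n → ℂˣ}
    (hM : ∀ m ∈ M, mon t m = 1)
    (hJ : ∀ i ∈ J, ∀ a ∈ A i, ∀ b ∈ A i, mon t (a - b) = 1) :
    ∀ m ∈ differenceLattice A M J, mon t m = 1 := by
  intro m hm
  induction hm using Submodule.span_induction with
  | mem m hm =>
    rcases hm with hm | ⟨i, hi, a, ha, b, hb, rfl⟩
    · exact hM m hm
    · exact hJ i hi a ha b hb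
  | zero => exact mon_zero t
  | add a b _ _ ha hb => rw [mon_add, ha, hb, one_mul]
  | smul k a _ ha => rw [mon_smul, ha, one_zpow]

lemma span_sup_colSpan_le (A : Fin n → Finset (Fin n → ℤ)) (M : AddSubgroup (Fin n → ℤ))
    (J : Finset (Fin n)) :
    Submodule.span ℝ ((fun m : Fin n → ℤ => fun j => (m j : ℝ)) '' (M : Set (Fin n → ℤ))) ⊔
        colSpan (fun i => realize (A i)) (J : Set (Fin n)) ≤
      Submodule.span ℝ (latticeEmb n '' differenceLattice A M J) := by
  refine sup_le (Submodule.span_le.2 ?_) (Submodule.span_le.2 ?_)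
  · rintro _ ⟨m, hm, rfl⟩
    exact Submodule.subset_span ⟨m, Submodule.subset_span (Or.inl hm), rfl⟩
  · rintro _ ⟨i, hi, _, ⟨a, ha, rfl⟩, _, ⟨b, hb, rfl⟩, rfl⟩
    refine Submodule.subset_span
      ⟨a - b, Submodule.subset_span (Or.inr ⟨i, hi, a, ha, b, hb, rfl⟩), ?_⟩
    exact map_sub (latticeEmb n) a b

end lattice

/-- Let `d(A) = 0`, let `T` be the algebraic subgroup of `(ℂ*)^n` cut out by a
subgroup `M ⊆ ℤ^n`, and let `L_T` be the span of `M`. If `T ∩ ker(G(A)) = {1}` and every proper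
subset `J` with `L_T ⊆ L(J)` has positive defect, then `A` is `T`-independent: the systems
having two distinct common roots differing by an element of `T` lie in a proper algebraic
subset of `Ω_A`. -/
theorem T_independence {n : ℕ} (hn : 1 ≤ n)
    (A : Fin n → Finset (Fin n → ℤ)) (hA : ∀ i, (A i).Nonempty)
    (hd : colMinDefectOn (fun i => realize (A i)) Finset.univ = 0)
    (M : AddSubgroup (Fin n → ℤ))
    (hker : ∀ t : Fin n → ℂˣ, (∀ m ∈ M, mon t m = 1) → inKer A t → t = 1)
    (hpos : ∀ J : Finset (Fin n), J ⊂ Finset.univ →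
      Submodule.span ℝ ((fun m : Fin n → ℤ => fun j => (m j : ℝ)) '' (M : Set (Fin n → ℤ))) ≤
          colSpan (fun i => realize (A i)) (J : Set (Fin n)) →
        0 < colDefect (fun i => realize (A i)) J) :
    ∃ F : MvPolynomial ((i : Fin n) × {x // x ∈ A i}) ℂ, F ≠ 0 ∧
      ∀ f : ∀ i, {x // x ∈ A i} → ℂ,
        (∃ p q : Fin n → ℂˣ, p ≠ q ∧ (∀ m ∈ M, mon (p * q⁻¹) m = 1) ∧
          (∀ i, evalL (f i) p = 0) ∧ (∀ i, evalL (f i) q = 0)) →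
        MvPolynomial.eval (fun v => f v.1 v.2) F = 0 := by
  classical
  have hnonneg (J : Finset (Fin n)) : 0 ≤ colDefect (fun i => realize (A i)) J :=
    hd.symm.le.trans (Finset.inf'_le _ (by simp))
  choose r φ B Z hZ hr hBZ using fun J => exists_basis_of_submodule (differenceLattice A M J)
  have hJr (J : Finset (Fin n)) (hJ : J ⊂ Finset.univ) : J.card < r J := by
    set L := colSpan (fun i => realize (A i)) (J : Set (Fin n))
    set LT := Submodule.span ℝ
      ((fun m : Fin n → ℤ => fun j => (m j : ℝ)) '' (M : Set (Fin n → ℤ)))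
    have hle : Module.finrank ℝ ↥(LT ⊔ L) ≤ r J := (Submodule.finrank_mono (span_sup_colSpan_le A M J)).trans (hr J)
    by_cases h : LT ≤ L
    · have h1 : 0 < (Module.finrank ℝ L : ℤ) - J.card := hpos J hJ h
      have h2 := Submodule.finrank_mono (le_sup_right : L ≤ LT ⊔ L)
      omega
    · have h1 : 0 ≤ (Module.finrank ℝ L : ℤ) - J.card := hnonneg J
      have h2 := Submodule.finrank_lt_finrank_of_lt (right_lt_sup.2 h)
      omega
  have hthin : Thin (⋃ J ∈ {J : Finset (Fin n) | J ⊂ Finset.univ},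
      ⋃ ab ∈ (Set.univ : Set ((∀ i, {x // x ∈ A i}) × (∀ i, {x // x ∈ A i}))), ⋃ ζ ∈ Z J,
      {c : ((i : Fin n) × {x // x ∈ A i}) → ℂ | ∃ p t : Fin n → ℂˣ,
        (∀ k, mon t (B J (φ J k)) = ζ k) ∧
        (∀ i ∉ J, mon p (ab.1 i).1 * mon (p * t) (ab.2 i).1 ≠
          mon p (ab.2 i).1 * mon (p * t) (ab.1 i).1) ∧
        (∀ i, evalL (fun x => c ⟨i, x⟩) p = 0) ∧
        (∀ i, evalL (fun x => c ⟨i, x⟩) (p * t) = 0)}) :=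
    Thin.biUnion (Set.toFinite _) fun J hJ => Thin.biUnion (Set.toFinite _) fun ab _ =>
      Thin.biUnion (hZ J) fun ζ _ => thin_of_card_lt_rank (hJr J hJ) ab.1 ab.2 (φ J) (B J) ζ
  obtain ⟨F, hF, hF'⟩ := hthin
  refine ⟨F, hF, fun f ⟨p, q, hpq, hM, hp, hq⟩ => hF' _ ?_⟩
  set t : Fin n → ℂˣ := q * p⁻¹ with ht
  have hpt : p * t = q := by rw [ht, mul_comm q, mul_inv_cancel_left]
  have htM : ∀ m ∈ M, mon t m = 1 := by
    intro m hm
    have : t = (p * q⁻¹)⁻¹ := by rw [ht, mul_inv_rev, inv_inv]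
    rw [this, mon_inv, hM m hm, inv_one]
  let J : Finset (Fin n) := {i | ∀ a ∈ A i, ∀ b ∈ A i, mon t (a - b) = 1}
  have hJ : J ⊂ Finset.univ := by
    rw [Finset.ssubset_univ_iff]
    intro h
    apply hpq
    have ht1 : t = 1 := hker t htM fun i => by
      have : i ∈ J := h ▸ Finset.mem_univ i
      simpa [J] using this
    rw [← hpt, ht1, mul_one]
  have hab (i : Fin n) : ∃ ab : {x // x ∈ A i} × {x // x ∈ A i},
      i ∉ J → mon p ab.1.1 * mon q ab.2.1 ≠ mon p ab.2.1 * mon q ab.1.1 := by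
    by_cases hi : i ∈ J
    · obtain ⟨a, ha⟩ := hA i
      exact ⟨(⟨a, ha⟩, ⟨a, ha⟩), fun h => absurd hi h⟩
    · have hi' := hi
      simp only [J, Finset.mem_filter, Finset.mem_univ, true_and] at hi'
      push Not at hi'
      obtain ⟨a, ha, b, hb, h⟩ := hi'
      refine ⟨(⟨a, ha⟩, ⟨b, hb⟩), fun _ he => h ?_⟩
      simp only [← hpt, mon_mul] at he
      rw [sub_eq_add_neg, mon_add, mon_neg, mul_inv_eq_one]
      have he2 : (mon p a * mon p b) * mon t b = (mon p a * mon p b) * mon t a := by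
        rw [mul_assoc, he]; ac_rfl
      exact (mul_left_cancel he2).symm
  choose ab hab using hab
  simp only [Set.mem_iUnion]
  refine ⟨J, hJ, (fun i => (ab i).1, fun i => (ab i).2), Set.mem_univ _,
    fun k => mon t (B J (φ J k)), hBZ J t ?_, p, t, fun _ => rfl, ?_, hp, ?_⟩
  · refine mon_eq_one_of_mem_differenceLattice htM fun i hi => ?_
    simpa [J] using hi
  · rw [hpt]; exact hab
  · rw [hpt]; exact hq
end
end
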